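/- arXiv:1905.11976 — 2 statements merged into one kernel-verified Lean document; each statement's English description precedes it below -/
import Mathlib

section
/- (Covariant r-matrix structure for NLS.) For all (q, r, q_x, r_x) ∈ ℂ⁴ and all λ, μ ∈ ℂ with λ ≠ μ, the NLS Lax matrices satisfy the two 4×4 matrix identities {U₁(q,r;λ), U₂(q,r;μ)}_S = −[r₁₂(λ,μ), U(q,r;λ)⊗I + I⊗U(q,r;μ)] and {V₁(q,r,q_x,r_x;λ), V₂(q,r,q_x,r_x;μ)}_T = [r₁₂(λ,μ), V(q,r,q_x,r_x;λ)⊗I + I⊗V(q,r,q_x,r_x;μ)], where r₁₂ is the rational classical r-matrix. -/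
noncomputable section

open Matrix Kronecker

def σ3 : Matrix (Fin 2) (Fin 2) ℂ := !![1, 0; 0, -1]
def σp : Matrix (Fin 2) (Fin 2) ℂ := !![0, 1; 0, 0]
def σm : Matrix (Fin 2) (Fin 2) ℂ := !![0, 0; 1, 0]
def I2 : Matrix (Fin 2) (Fin 2) ℂ := 1

/-- AKNS space Lax matrix as a function of (q, r) ∈ ℂ². -/
def Uak (lam : ℂ) (w : ℂ × ℂ) : Matrix (Fin 2) (Fin 2) ℂ :=
  (-(Complex.I * lam) / 2) • σ3 + w.1 • σp + w.2 • σm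

/-- NLS time Lax matrix as a function of (q, r, q_x, r_x) ∈ ℂ⁴. -/
def Vnls (lam : ℂ) (w : ℂ × ℂ × ℂ × ℂ) : Matrix (Fin 2) (Fin 2) ℂ :=
  (lam ^ 2 / (2 * Complex.I) - Complex.I * w.1 * w.2.1) • σ3
    + (lam * w.1 + Complex.I * w.2.2.1) • σp
    + (lam * w.2.1 - Complex.I * w.2.2.2) • σm

/-- single-time (space) Poisson bracket of functions of (q, r) ∈ ℂ². -/
def pbS (A C : ℂ × ℂ → ℂ) (p : ℂ × ℂ) : ℂ :=
  Complex.I * (fderiv ℂ A p (1, 0) * fderiv ℂ C p (0, 1)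
    - fderiv ℂ C p (1, 0) * fderiv ℂ A p (0, 1))

/-- single-time (time) Poisson bracket of functions of (q, r, q_x, r_x) ∈ ℂ⁴. -/
def pbT (B D : ℂ × ℂ × ℂ × ℂ → ℂ) (p : ℂ × ℂ × ℂ × ℂ) : ℂ :=
  fderiv ℂ B p (1, 0, 0, 0) * fderiv ℂ D p (0, 0, 0, 1)
    - fderiv ℂ D p (1, 0, 0, 0) * fderiv ℂ B p (0, 0, 0, 1)
    + fderiv ℂ B p (0, 1, 0, 0) * fderiv ℂ D p (0, 0, 1, 0)
    - fderiv ℂ D p (0, 1, 0, 0) * fderiv ℂ B p (0, 0, 1, 0)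

/-- {M₁, N₂}: 4×4 matrix whose ((i,k),(j,l)) entry is the bracket of M_{ij} with N_{kl}. -/
def matPBS (M N : ℂ × ℂ → Matrix (Fin 2) (Fin 2) ℂ) (p : ℂ × ℂ) :
    Matrix (Fin 2 × Fin 2) (Fin 2 × Fin 2) ℂ :=
  Matrix.of fun ik jl => pbS (fun w => M w ik.1 jl.1) (fun w => N w ik.2 jl.2) p

def matPBT (M N : ℂ × ℂ × ℂ × ℂ → Matrix (Fin 2) (Fin 2) ℂ) (p : ℂ × ℂ × ℂ × ℂ) :
    Matrix (Fin 2 × Fin 2) (Fin 2 × Fin 2) ℂ :=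
  Matrix.of fun ik jl => pbT (fun w => M w ik.1 jl.1) (fun w => N w ik.2 jl.2) p

/-- rational classical r-matrix. -/
def rRat (lam mu : ℂ) : Matrix (Fin 2 × Fin 2) (Fin 2 × Fin 2) ℂ :=
  (1 / (mu - lam)) •
    (σp ⊗ₖ σm + σm ⊗ₖ σp + (1 / 2 : ℂ) • (σ3 ⊗ₖ σ3) + (1 / 2 : ℂ) • (I2 ⊗ₖ I2))

set_option maxHeartbeats 4000000

/-- Derivative of a general entry of the space Lax matrix. -/
lemma fderiv_entryU (a b c : ℂ) (p v : ℂ × ℂ) :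
    fderiv ℂ (fun w : ℂ × ℂ => a + w.1 * b + w.2 * c) p v = v.1 * b + v.2 * c := by
  have h1 : HasFDerivAt (fun w : ℂ × ℂ => w.1) (ContinuousLinearMap.fst ℂ ℂ ℂ) p := hasFDerivAt_fst
  have h2 : HasFDerivAt (fun w : ℂ × ℂ => w.2) (ContinuousLinearMap.snd ℂ ℂ ℂ) p := hasFDerivAt_snd
  have := ((h1.mul_const b).const_add a).add (h2.mul_const c)
  rw [HasFDerivAt.fderiv (f := fun w : ℂ × ℂ => a + w.1 * b + w.2 * c) this]
  simp [mul_comm]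

/-- Derivative of a general entry of the time Lax matrix. -/
lemma fderiv_entryV (k l a b c : ℂ) (p v : ℂ × ℂ × ℂ × ℂ) :
    fderiv ℂ (fun w : ℂ × ℂ × ℂ × ℂ => (k - Complex.I * w.1 * w.2.1) * a
      + (l * w.1 + Complex.I * w.2.2.1) * b + (l * w.2.1 - Complex.I * w.2.2.2) * c) p v
    = -Complex.I * (v.1 * p.2.1 + p.1 * v.2.1) * a
      + (l * v.1 + Complex.I * v.2.2.1) * b + (l * v.2.1 - Complex.I * v.2.2.2) * c := by
  have h0 : HasFDerivAt (fun w : ℂ × ℂ × ℂ × ℂ => w) (ContinuousLinearMap.id ℂ _) p :=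
    hasFDerivAt_id p
  have h1 := h0.fst
  have h2 := h0.snd.fst
  have h3 := h0.snd.snd.fst
  have h4 := h0.snd.snd.snd
  have := (((((h1.const_mul Complex.I).mul h2).const_sub k).mul_const a).add
    (((h1.const_mul l).add (h3.const_mul Complex.I)).mul_const b)).add
    (((h2.const_mul l).sub (h4.const_mul Complex.I)).mul_const c)
  rw [HasFDerivAt.fderiv (f := fun w : ℂ × ℂ × ℂ × ℂ => (k - Complex.I * w.1 * w.2.1) * a
      + (l * w.1 + Complex.I * w.2.2.1) * b + (l * w.2.1 - Complex.I * w.2.2.2) * c) this]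
  simp
  ring

/-- Covariant r-matrix structure for NLS. -/
theorem covariant_r_matrix_NLS (q r qx rx : ℂ) (lam mu : ℂ) (h : lam ≠ mu) :
    matPBS (Uak lam) (Uak mu) (q, r)
      = -(rRat lam mu * (Uak lam (q, r) ⊗ₖ I2 + I2 ⊗ₖ Uak mu (q, r))
          - (Uak lam (q, r) ⊗ₖ I2 + I2 ⊗ₖ Uak mu (q, r)) * rRat lam mu)
    ∧ matPBT (Vnls lam) (Vnls mu) (q, r, qx, rx)
      = rRat lam mu * (Vnls lam (q, r, qx, rx) ⊗ₖ I2 + I2 ⊗ₖ Vnls mu (q, r, qx, rx))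
          - (Vnls lam (q, r, qx, rx) ⊗ₖ I2 + I2 ⊗ₖ Vnls mu (q, r, qx, rx)) * rRat lam mu := by
  have hd : mu - lam ≠ 0 := sub_ne_zero.mpr h.symm
  have hI : Complex.I ^ 2 = -1 := Complex.I_sq
  constructor
  · ext ⟨i, k⟩ ⟨j, l⟩
    simp only [matPBS, pbS, Uak, Matrix.of_apply, Matrix.add_apply, Matrix.smul_apply, smul_eq_mul,
      fderiv_entryU]
    fin_cases i <;> fin_cases k <;> fin_cases j <;> fin_cases l <;>
      simp [rRat, σ3, σp, σm, I2, Matrix.mul_apply, Fintype.sum_prod_type, Matrix.one_apply] <;>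
      field_simp <;> ring
  · ext ⟨i, k⟩ ⟨j, l⟩
    simp only [matPBT, pbT, Vnls, Matrix.of_apply, Matrix.add_apply, Matrix.smul_apply, smul_eq_mul,
      fderiv_entryV]
    fin_cases i <;> fin_cases k <;> fin_cases j <;> fin_cases l <;>
      simp [rRat, σ3, σp, σm, I2, Matrix.mul_apply, Fintype.sum_prod_type, Matrix.one_apply] <;>
      field_simp <;> ring_nf <;> simp [hI] <;> ring
end
end

section
/- (Sklyanin relation for the AKNS space Lax matrix.) For all (q, r) ∈ ℂ² and all λ, μ ∈ ℂ with λ ≠ μ, the 4×4 matrix identity {U₁(q,r;λ), U₂(q,r;μ)}_S = −[r₁₂(λ,μ), U(q,r;λ)⊗I + I⊗U(q,r;μ)] holds, where r₁₂ is the rational classical r-matrix. -/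
noncomputable section

open Matrix Kronecker

theorem fderiv_Uak (lam : ℂ) (p v : ℂ × ℂ) (i j : Fin 2) :
    fderiv ℂ (fun w => Uak lam w i j) p v = v.1 * σp i j + v.2 * σm i j := by
  have h : HasFDerivAt (fun w : ℂ × ℂ => Uak lam w i j)
      ((σp i j) • ContinuousLinearMap.fst ℂ ℂ ℂ + (σm i j) • ContinuousLinearMap.snd ℂ ℂ ℂ) p := by
    have h1 := (hasFDerivAt_fst (𝕜 := ℂ) (p := p)).mul_const (σp i j)
    have h2 := (hasFDerivAt_snd (𝕜 := ℂ) (p := p)).mul_const (σm i j)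
    have h3 := (h1.add h2).const_add ((-(Complex.I * lam) / 2) * σ3 i j)
    refine h3.congr_of_eventuallyEq (Filter.Eventually.of_forall fun w => ?_)
    simp [Uak, add_assoc]
  rw [h.fderiv]
  simp [mul_comm]

/-- Sklyanin relation for the AKNS space Lax matrix. -/
theorem sklyanin_AKNS_U (q r : ℂ) (lam mu : ℂ) (h : lam ≠ mu) :
    matPBS (Uak lam) (Uak mu) (q, r)
      = -(rRat lam mu * (Uak lam (q, r) ⊗ₖ I2 + I2 ⊗ₖ Uak mu (q, r))
          - (Uak lam (q, r) ⊗ₖ I2 + I2 ⊗ₖ Uak mu (q, r)) * rRat lam mu) := by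
  have h' : mu - lam ≠ 0 := sub_ne_zero.mpr (Ne.symm h)
  ext ⟨i, k⟩ ⟨j, l⟩
  simp only [matPBS, pbS, Matrix.of_apply, fderiv_Uak]
  fin_cases i <;> fin_cases k <;> fin_cases j <;> fin_cases l <;>
    simp [rRat, Uak, σ3, σp, σm, I2, Matrix.mul_apply, Fintype.sum_prod_type,
      Matrix.one_apply] <;> (try field_simp) <;> (try ring)
end
end
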